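/- arXiv:math/0309236 — 3 statements merged into one kernel-verified Lean document; each statement's English description precedes it below -/
import Mathlib

section
/- Let B = diag(b_1, b_2) be a positive invertible diagonal operator on ℝ² with b_1 ≥ b_2 > 0, and let c_1 ≥ c_2 ≥ ... ≥ c_k > 0 be positive real numbers with c_1 + ... + c_k = b_1 + b_2. If c_1 ≤ b_1, then there exist unit vectors x_1, ..., x_k in ℝ² such that B = Σ_{i=1}^k c_i (x_i ⊗ x_i). -/
open scoped InnerProductSpace

/-- The rank-one operator `u ⊗ v : x ↦ ⟨x, v⟩ u` (inner product linear in `x`). -/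
noncomputable def rankOne (𝕜 : Type*) {E : Type*} [RCLike 𝕜] [NormedAddCommGroup E]
    [InnerProductSpace 𝕜 E] (u v : E) : E →L[𝕜] E :=
  (innerSL 𝕜 v).smulRight u

open Complex in
/-- Two sides `r`, `c` of a triangle with third side `d` close up in the plane. -/
theorem exists_angles_of_triangle {r c d : ℝ} (hc : 0 ≤ c) (hd : 0 ≤ d)
    (h₁ : |d - c| ≤ r) (h₂ : r ≤ d + c) :
    ∃ α β : ℝ, (r : ℂ) * exp (α * I) + c * exp (β * I) = d := by
  have hcont : ContinuousOn (fun β : ℝ => ‖(d : ℂ) - c * exp (β * I)‖) (Set.Icc 0 Real.pi) := by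
    fun_prop
  have hr : r ∈ Set.Icc ‖(d : ℂ) - c * exp ((0 : ℝ) * I)‖ ‖(d : ℂ) - c * exp (Real.pi * I)‖ := by
    constructor
    · have h : (d : ℂ) - c * exp ((0 : ℝ) * I) = ((d - c : ℝ) : ℂ) := by simp
      rw [h, norm_real]
      exact h₁
    · have h : (d : ℂ) - c * exp (Real.pi * I) = ((d + c : ℝ) : ℂ) := by simp [exp_pi_mul_I]
      rw [h, norm_real, Real.norm_of_nonneg (by positivity)]
      exact h₂
  obtain ⟨β, -, hβ⟩ := intermediate_value_Icc Real.pi_pos.le hcont hr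
  refine ⟨arg (d - c * exp (β * I)), β, ?_⟩
  have h := norm_mul_exp_arg_mul_I ((d : ℂ) - c * exp (β * I))
  dsimp only at hβ
  rw [hβ] at h
  rw [h]
  ring

open Complex in
/-- Polygon inequality, converse direction: `c 0 ≥ ⋯ ≥ c n ≥ 0` are the lengths of a planar
path whose end points are at distance `d`, as soon as `2 c 0 - ∑ c i ≤ d ≤ ∑ c i`. -/
theorem exists_angles_of_polygon (c : ℕ → ℝ) (n : ℕ) (hle : ∀ i ≤ n, c i ≤ c 0)
    (hc : ∀ i ≤ n, 0 ≤ c i) (d : ℝ) (hd : 0 ≤ d)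
    (h₁ : 2 * c 0 - ∑ i ∈ Finset.range (n + 1), c i ≤ d)
    (h₂ : d ≤ ∑ i ∈ Finset.range (n + 1), c i) :
    ∃ θ : ℕ → ℝ, ∑ i ∈ Finset.range (n + 1), (c i : ℂ) * exp (θ i * I) = d := by
  induction n generalizing d with
  | zero =>
    simp only [zero_add, Finset.sum_range_one] at h₁ h₂ ⊢
    obtain rfl : d = c 0 := by linarith
    exact ⟨0, by simp⟩
  | succ n ih =>
    rw [Finset.sum_range_succ] at h₁ h₂
    set S := ∑ i ∈ Finset.range (n + 1), c i with hS
    have hcn := hc (n + 1) le_rfl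
    have hlen := hle (n + 1) le_rfl
    have h0S : c 0 ≤ S := Finset.single_le_sum (f := c)
      (fun i hi => hc i (by simp at hi; omega)) (by simp)
    have habs : |d - c (n + 1)| ≤ S := abs_le.2 ⟨by linarith, by linarith⟩
    have habs' : |d - c (n + 1)| ≤ d + c (n + 1) := abs_le.2 ⟨by linarith, by linarith⟩
    obtain ⟨θ, hθ⟩ := ih (fun i hi => hle i (by omega)) (fun i hi => hc i (by omega))
      (max |d - c (n + 1)| (2 * c 0 - S)) (le_max_of_le_left (abs_nonneg _))
      (le_max_right _ _) (max_le habs (by linarith))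
    obtain ⟨α, β, hαβ⟩ := exists_angles_of_triangle hcn hd
      (le_max_left _ (2 * c 0 - S)) (max_le habs' (by linarith))
    refine ⟨fun i => if i = n + 1 then β else θ i + α, ?_⟩
    rw [Finset.sum_range_succ, ← hαβ, ← hθ, Finset.sum_mul]
    congr 1
    · refine Finset.sum_congr rfl fun i hi => ?_
      beta_reduce
      rw [if_neg (Finset.mem_range.1 hi).ne, mul_assoc, ← exp_add]
      push_cast
      ring_nf
    · simp

/-- Let `B = diag (b₁, b₂)` on `ℝ²` with `b₁ ≥ b₂ > 0`, and let `c 0 ≥ c 1 ≥ ⋯ ≥ c (k-1) > 0`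
with `∑_{i<k} c i = b₁ + b₂`. If `c 0 ≤ b₁`, then there exist unit vectors
`x 0, …, x (k-1)` in `ℝ²` such that `B = ∑_{i<k} c i (x i ⊗ x i)`. -/
theorem rank_one_decomposition_R2 (b₁ b₂ : ℝ) (hb : b₂ ≤ b₁) (hb2 : 0 < b₂)
    (k : ℕ) (c : ℕ → ℝ)
    (hcmono : ∀ i j, i ≤ j → j < k → c j ≤ c i)
    (hcpos : ∀ i < k, 0 < c i)
    (hsum : ∑ i ∈ Finset.range k, c i = b₁ + b₂)
    (hc1 : c 0 ≤ b₁) :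
    ∃ x : ℕ → EuclideanSpace ℝ (Fin 2), (∀ i < k, ‖x i‖ = 1) ∧
      (Matrix.toEuclideanCLM (𝕜 := ℝ) (Matrix.diagonal ![b₁, b₂])) =
        ∑ i ∈ Finset.range k, c i • rankOne ℝ (x i) (x i) := by
  have hk : k ≠ 0 := by
    rintro rfl
    simp at hsum
    linarith
  obtain ⟨n, rfl⟩ := Nat.exists_eq_succ_of_ne_zero hk
  simp only [Nat.succ_eq_add_one] at *
  obtain ⟨θ, hθ⟩ := exists_angles_of_polygon c n (fun i hi => hcmono 0 i (by omega) (by omega))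
    (fun i hi => (hcpos i (by omega)).le) (b₁ - b₂) (by linarith) (by linarith) (by linarith)
  have hre : ∑ i ∈ Finset.range (n + 1), c i * Real.cos (θ i) = b₁ - b₂ := by
    simpa [Complex.exp_ofReal_mul_I_re] using congrArg Complex.re hθ
  have him : ∑ i ∈ Finset.range (n + 1), c i * Real.sin (θ i) = 0 := by
    simpa [Complex.exp_ofReal_mul_I_im] using congrArg Complex.im hθ
  have hcos (t : ℝ) : Real.cos t = 2 * Real.cos (t / 2) ^ 2 - 1 := by
    rw [← Real.cos_two_mul, mul_div_cancel₀ t two_ne_zero]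
  have hsin (t : ℝ) : Real.sin t = 2 * Real.sin (t / 2) * Real.cos (t / 2) := by
    rw [← Real.sin_two_mul, mul_div_cancel₀ t two_ne_zero]
  have hcc : ∑ i ∈ Finset.range (n + 1), c i * Real.cos (θ i / 2) ^ 2 = b₁ := by
    have h : ∑ i ∈ Finset.range (n + 1), c i * Real.cos (θ i / 2) ^ 2 =
        (∑ i ∈ Finset.range (n + 1), c i * Real.cos (θ i) +
          ∑ i ∈ Finset.range (n + 1), c i) / 2 := by
      rw [← Finset.sum_add_distrib, Finset.sum_div]
      exact Finset.sum_congr rfl fun i _ => by rw [hcos (θ i)]; ring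
    rw [h, hre, hsum]
    ring
  have hsc : ∑ i ∈ Finset.range (n + 1), c i * (Real.sin (θ i / 2) * Real.cos (θ i / 2)) = 0 := by
    have h : ∑ i ∈ Finset.range (n + 1), c i * (Real.sin (θ i / 2) * Real.cos (θ i / 2)) =
        (∑ i ∈ Finset.range (n + 1), c i * Real.sin (θ i)) / 2 := by
      rw [Finset.sum_div]
      exact Finset.sum_congr rfl fun i _ => by rw [hsin (θ i)]; ring
    rw [h, him, zero_div]
  have hss : ∑ i ∈ Finset.range (n + 1), c i * Real.sin (θ i / 2) ^ 2 = b₂ := by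
    have h : ∑ i ∈ Finset.range (n + 1), c i * Real.sin (θ i / 2) ^ 2 =
        ∑ i ∈ Finset.range (n + 1), c i -
          ∑ i ∈ Finset.range (n + 1), c i * Real.cos (θ i / 2) ^ 2 := by
      rw [← Finset.sum_sub_distrib]
      exact Finset.sum_congr rfl fun i _ => by rw [Real.sin_sq]; ring
    rw [h, hcc, hsum]
    ring
  refine ⟨fun i => !₂[Real.cos (θ i / 2), Real.sin (θ i / 2)], fun i _ => ?_, ?_⟩
  · simp [EuclideanSpace.norm_eq, Fin.sum_univ_two]
  · ext v j
    fin_cases j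
    · have h : b₁ * v 0 = ∑ i ∈ Finset.range (n + 1), c i *
          ((v 0 * Real.cos (θ i / 2) + v 1 * Real.sin (θ i / 2)) * Real.cos (θ i / 2)) := by
        calc b₁ * v 0 = (∑ i ∈ Finset.range (n + 1), c i * Real.cos (θ i / 2) ^ 2) * v 0 +
              (∑ i ∈ Finset.range (n + 1),
                c i * (Real.sin (θ i / 2) * Real.cos (θ i / 2))) * v 1 := by
              rw [hcc, hsc]; ring
          _ = _ := by
              rw [Finset.sum_mul, Finset.sum_mul, ← Finset.sum_add_distrib]
              exact Finset.sum_congr rfl fun i _ => by ring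
      simpa [rankOne, Matrix.mulVec_diagonal, PiLp.inner_apply, Fin.sum_univ_two] using h
    · have h : b₂ * v 1 = ∑ i ∈ Finset.range (n + 1), c i *
          ((v 0 * Real.cos (θ i / 2) + v 1 * Real.sin (θ i / 2)) * Real.sin (θ i / 2)) := by
        calc b₂ * v 1 = (∑ i ∈ Finset.range (n + 1),
                c i * (Real.sin (θ i / 2) * Real.cos (θ i / 2))) * v 0 +
              (∑ i ∈ Finset.range (n + 1), c i * Real.sin (θ i / 2) ^ 2) * v 1 := by
              rw [hss, hsc]; ring
          _ = _ := by
              rw [Finset.sum_mul, Finset.sum_mul, ← Finset.sum_add_distrib]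
              exact Finset.sum_congr rfl fun i _ => by ring
      simpa [rankOne, Matrix.mulVec_diagonal, PiLp.inner_apply, Fin.sum_univ_two] using h
end

section
/- Let H be a real or complex inner product space of finite dimension n, let B be a positive invertible operator on H with eigenvalues b_1 ≥ b_2 ≥ ... ≥ b_n > 0, and for k ≥ n let c_1 ≥ c_2 ≥ ... ≥ c_k > 0 be positive reals with c_1 + ... + c_k = b_1 + ... + b_n. Then there exists a family of k vectors x_1, ..., x_k in H whose frame operator (the operator x ↦ Σ_{i=1}^k ⟨x, x_i⟩ x_i) equals B and with ‖x_i‖ = √(c_i) for 1 ≤ i ≤ k, if and only if for every p with 1 ≤ p ≤ n-1 one has c_1 + ... + c_p ≤ b_1 + ... + b_p. -/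
open scoped InnerProductSpace

/-- If a property of real sequences is stable under transfers that bring two entries `a j ≥ a l`
closer together (or swap them), then it passes from `a` to any non-increasing sequence whose
partial sums are dominated by those of `a`, with the same total. -/
theorem exists_eqOn_of_transfer_of_sum_range_le {k : ℕ} {c : ℕ → ℝ} {P : (ℕ → ℝ) → Prop}
    (hc : ∀ i j, i ≤ j → j < k → c j ≤ c i)
    (hP : ∀ a j l δ, j < k → l < k → j ≠ l → 0 ≤ δ → δ ≤ a j - a l → P a →
      P fun i => a i - (if i = j then δ else 0) + (if i = l then δ else 0))
    (a : ℕ → ℝ) (ha : P a)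
    (hle : ∀ p ≤ k, ∑ i ∈ Finset.range p, c i ≤ ∑ i ∈ Finset.range p, a i)
    (hsum : ∑ i ∈ Finset.range k, c i = ∑ i ∈ Finset.range k, a i) :
    ∃ a', P a' ∧ ∀ i < k, a' i = c i := by
  induction h : ((Finset.range k).filter fun i => a i ≠ c i).card using
    Nat.strong_induction_on generalizing a with
  | _ m ih =>
  by_cases hac : ∀ i < k, a i = c i
  · exact ⟨a, ha, hac⟩
  obtain ⟨j, hjk, hj⟩ : ∃ j < k, c j < a j := by
    by_contra! hcon
    refine hac fun i hi => ?_
    exact (Finset.sum_eq_sum_iff_of_le fun i hi => hcon i (Finset.mem_range.1 hi)).1 hsum.symm i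
      (Finset.mem_range.2 hi)
  have mono : ∀ p, j + 1 ≤ p → (∀ i, j < i → i < p → c i ≤ a i) → p ≤ k →
      a j - c j ≤ ∑ i ∈ Finset.range p, a i - ∑ i ∈ Finset.range p, c i := by
    intro p hp
    induction p, hp using Nat.le_induction with
    | base =>
      intro _ _
      have := hle j hjk.le
      rw [Finset.sum_range_succ, Finset.sum_range_succ]
      linarith
    | succ p hp IH =>
      intro h1 h2
      have := IH (fun i hi hi' => h1 i hi (by lia)) (by lia)
      have := h1 p (by lia) (by lia)
      rw [Finset.sum_range_succ, Finset.sum_range_succ]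
      linarith
  have hex : ∃ l, j < l ∧ l < k ∧ a l < c l := by
    by_contra! hcon
    have := mono k hjk hcon le_rfl
    linarith
  classical
  obtain ⟨hjl, hlk, hl⟩ := Nat.find_spec hex
  have hmin : ∀ i, j < i → i < Nat.find hex → c i ≤ a i := by
    intro i hi hi'
    have := Nat.find_min hex hi'
    push Not at this
    exact this hi (by lia)
  generalize Nat.find hex = l at hjl hlk hl hmin
  have hcjl := hc j l hjl.le hlk
  set δ := min (a j - c j) (c l - a l) with hδ
  have hδ0 : 0 < δ := lt_min (by linarith) (by linarith)
  have hδj : δ ≤ a j - c j := min_le_left _ _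
  have hδl : δ ≤ c l - a l := min_le_right _ _
  have hsum' : ∀ p, ∑ i ∈ Finset.range p,
      (a i - (if i = j then δ else 0) + (if i = l then δ else 0)) =
      ∑ i ∈ Finset.range p, a i - (if j < p then δ else 0) + (if l < p then δ else 0) := by
    intro p
    simp [Finset.sum_add_distrib, Finset.sum_sub_distrib]
  refine ih _ ?_ _ (hP a j l δ hjk hlk hjl.ne hδ0.le (by linarith) ha) ?_ ?_ rfl
  · rw [← h]
    apply Finset.card_lt_card
    rw [Finset.ssubset_iff_of_subset]
    · rcases min_choice (a j - c j) (c l - a l) with h' | h' <;> rw [← hδ] at h'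
      · exact ⟨j, by simp [hjk, hj.ne'], by simp [hjl.ne, h']⟩
      · exact ⟨l, by simp [hlk, hl.ne], by simp [hjl.ne', h']⟩
    · intro i hi
      simp only [Finset.mem_filter, Finset.mem_range] at hi ⊢
      refine ⟨hi.1, fun hi' => hi.2 ?_⟩
      have h1 : i ≠ j := by rintro rfl; linarith
      have h2 : i ≠ l := by rintro rfl; linarith
      simp [h1, h2, hi']
  · intro p hp
    rw [hsum']
    have := hle p hp
    by_cases h1 : l < p
    · simp only [h1, hjl.trans h1, if_true]; linarith
    · by_cases h2 : j < p
      · have := mono p h2 (fun i hi hi' => hmin i hi (by lia)) hp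
        simp only [h1, h2, if_true, if_false]; linarith
      · simp only [h1, h2, if_false]; linarith
  · rw [hsum']
    simp [hjk, hlk, hsum]

section InnerProductSpace

variable {𝕜 E : Type*} [RCLike 𝕜] [NormedAddCommGroup E] [InnerProductSpace 𝕜 E]

theorem norm_rotation_sq_add (u v : E) (r s : ℝ) :
    ‖(r : 𝕜) • u + (s : 𝕜) • v‖ ^ 2 + ‖(-s : 𝕜) • u + (r : 𝕜) • v‖ ^ 2 =
      (r ^ 2 + s ^ 2) * (‖u‖ ^ 2 + ‖v‖ ^ 2) := by
  rw [norm_add_sq (𝕜 := 𝕜), norm_add_sq (𝕜 := 𝕜)]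
  simp only [norm_smul, norm_neg, RCLike.norm_ofReal, mul_pow, sq_abs, neg_smul, inner_neg_left,
    map_neg, inner_smul_left, inner_smul_right, RCLike.conj_ofReal, RCLike.re_ofReal_mul]
  ring

theorem rankOne_rotation_add (u v w : E) (r s : ℝ) (hrs : r ^ 2 + s ^ 2 = 1) :
    ⟪(r : 𝕜) • u + (s : 𝕜) • v, w⟫_𝕜 • ((r : 𝕜) • u + (s : 𝕜) • v) +
      ⟪(-s : 𝕜) • u + (r : 𝕜) • v, w⟫_𝕜 • ((-s : 𝕜) • u + (r : 𝕜) • v) =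
      ⟪u, w⟫_𝕜 • u + ⟪v, w⟫_𝕜 • v := by
  have h : (r : 𝕜) ^ 2 + (s : 𝕜) ^ 2 = 1 := by exact_mod_cast congrArg (RCLike.ofReal (K := 𝕜)) hrs
  simp only [inner_add_left, inner_smul_left, RCLike.conj_ofReal, map_neg]
  match_scalars
  · linear_combination ⟪u, w⟫_𝕜 * h
  · linear_combination ⟪v, w⟫_𝕜 * h

/-- A pair of vectors can be rotated to have a prescribed intermediate norm. -/
theorem exists_rotation_norm_sq_eq (u v : E) {t : ℝ} (ht : ‖v‖ ^ 2 ≤ t) (ht' : t ≤ ‖u‖ ^ 2) :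
    ∃ r s : ℝ, r ^ 2 + s ^ 2 = 1 ∧ ‖(r : 𝕜) • u + (s : 𝕜) • v‖ ^ 2 = t := by
  have hcont : ContinuousOn (fun θ : ℝ =>
      ‖((Real.cos θ : ℝ) : 𝕜) • u + ((Real.sin θ : ℝ) : 𝕜) • v‖ ^ 2)
      (Set.Icc 0 (Real.pi / 2)) := by
    have : Continuous (RCLike.ofReal : ℝ → 𝕜) := RCLike.continuous_ofReal
    fun_prop
  obtain ⟨θ, -, hθ⟩ := intermediate_value_Icc' (by positivity) hcont
    (show t ∈ Set.Icc _ _ by simpa using ⟨ht, ht'⟩)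
  exact ⟨Real.cos θ, Real.sin θ, Real.cos_sq_add_sin_sq θ, hθ⟩

/-- Rotating two vectors of a family keeps its frame operator and transfers squared norm. -/
theorem exists_frame_transfer {k : ℕ} {B : E → E} {a : ℕ → ℝ} {j l : ℕ} {δ : ℝ}
    (hj : j < k) (hl : l < k) (hjl : j ≠ l) (hδ : 0 ≤ δ) (hδ' : δ ≤ a j - a l)
    (h : ∃ x : ℕ → E, (∀ i < k, ‖x i‖ ^ 2 = a i) ∧
      ∀ v : E, B v = ∑ i ∈ Finset.range k, ⟪x i, v⟫_𝕜 • x i) :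
    ∃ x : ℕ → E, (∀ i < k, ‖x i‖ ^ 2 =
        a i - (if i = j then δ else 0) + (if i = l then δ else 0)) ∧
      ∀ v : E, B v = ∑ i ∈ Finset.range k, ⟪x i, v⟫_𝕜 • x i := by
  obtain ⟨x, hx, hBx⟩ := h
  obtain ⟨r, s, hrs, hn⟩ := exists_rotation_norm_sq_eq (𝕜 := 𝕜) (x j) (x l) (t := a j - δ)
    (by rw [hx l hl]; linarith) (by rw [hx j hj]; linarith)
  have hn' := norm_rotation_sq_add (𝕜 := 𝕜) (x j) (x l) r s
  rw [hn, hrs, hx j hj, hx l hl] at hn'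
  refine ⟨fun i => if i = j then (r : 𝕜) • x j + (s : 𝕜) • x l else
    if i = l then (-s : 𝕜) • x j + (r : 𝕜) • x l else x i, fun i hi => ?_, fun v => ?_⟩
  · by_cases h1 : i = j
    · subst h1
      simp [hjl, hn]
    · by_cases h2 : i = l
      · subst h2
        simp only [h1, if_true, if_false]
        linarith
      · simp [h1, h2, hx i hi]
  · have hlm : l ∈ (Finset.range k).erase j := by simp [hl, hjl.symm]
    rw [hBx v, ← Finset.add_sum_erase _ _ (Finset.mem_range.2 hj),
      ← Finset.add_sum_erase _ _ hlm, ← Finset.add_sum_erase _ _ (Finset.mem_range.2 hj),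
      ← Finset.add_sum_erase _ _ hlm, ← add_assoc, ← add_assoc]
    congr 1
    · simp only [if_true, hjl.symm, if_false]
      exact (rankOne_rotation_add _ _ _ r s hrs).symm
    · refine Finset.sum_congr rfl fun i hi => ?_
      simp only [Finset.mem_erase] at hi
      simp [hi.1, hi.2.1]

end InnerProductSpace

/-- A weighted sum of a non-increasing sequence, with weights in `[0, 1]` of total at most `p`,
is at most the sum of the first `p` terms. -/
theorem sum_mul_le_sum_range {n p : ℕ} {b w : ℕ → ℝ} (hp : p < n) (hbp : 0 ≤ b p)
    (hb : ∀ i j, i ≤ j → j < n → b j ≤ b i) (hw0 : ∀ i < n, 0 ≤ w i) (hw1 : ∀ i < n, w i ≤ 1)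
    (hw : ∑ i ∈ Finset.range n, w i ≤ p) :
    ∑ i ∈ Finset.range n, b i * w i ≤ ∑ i ∈ Finset.range p, b i := by
  have h1 : ∑ i ∈ Finset.range n, (b i - b p) * w i ≤ ∑ i ∈ Finset.range p, (b i - b p) := by
    rw [← Finset.sum_range_add_sum_Ico _ hp.le]
    have h2 : ∑ i ∈ Finset.range p, (b i - b p) * w i ≤ ∑ i ∈ Finset.range p, (b i - b p) := by
      refine Finset.sum_le_sum fun i hi => ?_
      have hi := Finset.mem_range.1 hi
      exact mul_le_of_le_one_right (by linarith [hb i p hi.le hp]) (hw1 i (by lia))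
    have h3 : ∑ i ∈ Finset.Ico p n, (b i - b p) * w i ≤ 0 := by
      refine Finset.sum_nonpos fun i hi => ?_
      have hi := Finset.mem_Ico.1 hi
      exact mul_nonpos_of_nonpos_of_nonneg (by linarith [hb p i hi.1 hi.2]) (hw0 i hi.2)
    linarith
  have h4 := mul_le_mul_of_nonneg_left hw hbp
  simp only [sub_mul, Finset.sum_sub_distrib, ← Finset.mul_sum, Finset.sum_const,
    Finset.card_range, nsmul_eq_mul] at h1
  linarith

section InnerProductSpace

variable {𝕜 E : Type*} [RCLike 𝕜] [NormedAddCommGroup E] [InnerProductSpace 𝕜 E]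

theorem re_inner_sum_rankOne {ι : Type*} (s : Finset ι) (b : ι → ℝ) (x : ι → E) (u : E) :
    RCLike.re ⟪u, ∑ i ∈ s, (b i : 𝕜) • ⟪x i, u⟫_𝕜 • x i⟫_𝕜 = ∑ i ∈ s, b i * ‖⟪u, x i⟫_𝕜‖ ^ 2 := by
  simp only [inner_sum, map_sum, inner_smul_right, RCLike.re_ofReal_mul]
  refine Finset.sum_congr rfl fun i _ => ?_
  rw [← inner_conj_symm, RCLike.conj_mul]
  norm_cast

theorem apply_eq_sum_of_orthonormal_eigenvectors [FiniteDimensional 𝕜 E] {B : E →L[𝕜] E} {n : ℕ}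
    (hn : Module.finrank 𝕜 E = n) {b : ℕ → ℝ} {e : ℕ → E}
    (he : Orthonormal 𝕜 (fun i : Fin n => e i)) (heig : ∀ i < n, B (e i) = (b i : 𝕜) • e i)
    (v : E) : B v = ∑ i ∈ Finset.range n, (b i : 𝕜) • ⟪e i, v⟫_𝕜 • e i := by
  let o := OrthonormalBasis.mk he
    (he.linearIndependent.span_eq_top_of_card_eq_finrank' (by simp [hn])).ge
  have ho : ∀ i : Fin n, o i = e i := fun i => by simp [o]
  conv_lhs => rw [← o.sum_repr' v]
  rw [Finset.sum_range, map_sum]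
  refine Finset.sum_congr rfl fun i _ => ?_
  rw [map_smul, ho, heig i i.2, smul_comm]

/-- Part of the trace of a frame operator is controlled by its largest eigenvalues. -/
theorem sum_norm_sq_le_sum_eigenvalues {n k p : ℕ} (hp : p < n) (hpk : p ≤ k)
    {b : ℕ → ℝ} {e x : ℕ → E} (he : Orthonormal 𝕜 (fun i : Fin n => e i))
    (hb : ∀ i j, i ≤ j → j < n → b j ≤ b i) (hbp : 0 ≤ b p)
    (h : ∀ v : E, ∑ i ∈ Finset.range k, ⟪x i, v⟫_𝕜 • x i =
      ∑ i ∈ Finset.range n, (b i : 𝕜) • ⟪e i, v⟫_𝕜 • e i) :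
    ∑ i ∈ Finset.range p, ‖x i‖ ^ 2 ≤ ∑ i ∈ Finset.range p, b i := by
  let W : Submodule 𝕜 E := Submodule.span 𝕜 (Set.range fun i : Fin p => x i)
  have : FiniteDimensional 𝕜 W := FiniteDimensional.span_of_finite 𝕜 (Set.finite_range _)
  have hW : Module.finrank 𝕜 W ≤ p := (finrank_range_le_card _).trans_eq (by simp)
  let u := stdOrthonormalBasis 𝕜 W
  have huo : Orthonormal 𝕜 fun j => (u j : E) := u.orthonormal.comp_linearIsometry W.subtypeₗᵢ
  have hx : ∀ i < p, ‖x i‖ ^ 2 = ∑ j, ‖⟪(u j : E), x i⟫_𝕜‖ ^ 2 := fun i hi =>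
    (u.sum_sq_norm_inner_right ⟨x i, Submodule.subset_span ⟨⟨i, hi⟩, rfl⟩⟩).symm
  have hu : ∀ j, ∑ i ∈ Finset.range k, ‖⟪(u j : E), x i⟫_𝕜‖ ^ 2 =
      ∑ l ∈ Finset.range n, b l * ‖⟪(u j : E), e l⟫_𝕜‖ ^ 2 := fun j => by
    have h1 := re_inner_sum_rankOne (𝕜 := 𝕜) (Finset.range k) (fun _ => 1) x (u j : E)
    have h2 := re_inner_sum_rankOne (𝕜 := 𝕜) (Finset.range n) b e (u j : E)
    rw [← h] at h2
    simp only [RCLike.ofReal_one, one_smul, one_mul] at h1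
    exact h1.symm.trans h2
  calc ∑ i ∈ Finset.range p, ‖x i‖ ^ 2
      = ∑ i ∈ Finset.range p, ∑ j, ‖⟪(u j : E), x i⟫_𝕜‖ ^ 2 :=
        Finset.sum_congr rfl fun i hi => hx i (Finset.mem_range.1 hi)
    _ ≤ ∑ i ∈ Finset.range k, ∑ j, ‖⟪(u j : E), x i⟫_𝕜‖ ^ 2 :=
        Finset.sum_le_sum_of_subset_of_nonneg (Finset.range_mono hpk)
          fun _ _ _ => by positivity
    _ = ∑ l ∈ Finset.range n, b l * ∑ j, ‖⟪(u j : E), e l⟫_𝕜‖ ^ 2 := by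
        rw [Finset.sum_comm]
        simp only [hu, Finset.mul_sum]
        rw [Finset.sum_comm]
    _ ≤ ∑ i ∈ Finset.range p, b i := by
        refine sum_mul_le_sum_range hp hbp hb (fun _ _ => by positivity) (fun l hl => ?_) ?_
        · refine (huo.sum_inner_products_le (e l)).trans_eq ?_
          rw [he.1 ⟨l, hl⟩, one_pow]
        · rw [Finset.sum_comm]
          calc ∑ j, ∑ l ∈ Finset.range n, ‖⟪(u j : E), e l⟫_𝕜‖ ^ 2
              ≤ ∑ j, (1 : ℝ) := Finset.sum_le_sum fun j _ => by
                have := he.sum_inner_products_le (u j : E) (s := Finset.univ)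
                rw [huo.1 j, one_pow] at this
                simpa only [Finset.sum_range, norm_inner_symm] using this
            _ ≤ p := by simpa using hW

end InnerProductSpace

/-- Let `H` be a real or complex inner product space of finite dimension `n`, let `B` be a
positive invertible operator on `H` with eigenvalues `b 0 ≥ ⋯ ≥ b (n-1) > 0` (with a
corresponding orthonormal basis of eigenvectors), and for `k ≥ n` let
`c 0 ≥ ⋯ ≥ c (k-1) > 0` with `∑_{i<k} c i = ∑_{i<n} b i`. Then there is a family of `k`
vectors `x i` whose frame operator `v ↦ ∑_{i<k} ⟨v, x i⟩ x i` equals `B` with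
`‖x i‖ = √(c i)`, if and only if `∑_{i<p} c i ≤ ∑_{i<p} b i` for all `1 ≤ p ≤ n - 1`. -/
theorem frame_with_frame_operator_iff {𝕜 E : Type*} [RCLike 𝕜] [NormedAddCommGroup E]
    [InnerProductSpace 𝕜 E] [FiniteDimensional 𝕜 E] [CompleteSpace E]
    (B : E →L[𝕜] E) (hB : B.IsPositive) (hBinv : IsUnit B)
    (n k : ℕ) (hn : Module.finrank 𝕜 E = n) (hnk : n ≤ k)
    (b c : ℕ → ℝ) (e : ℕ → E)
    (he : Orthonormal 𝕜 (fun i : Fin n => e i))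
    (heig : ∀ i < n, B (e i) = (b i : 𝕜) • e i)
    (hbmono : ∀ i j, i ≤ j → j < n → b j ≤ b i)
    (hbpos : ∀ i < n, 0 < b i)
    (hcmono : ∀ i j, i ≤ j → j < k → c j ≤ c i)
    (hcpos : ∀ i < k, 0 < c i)
    (hsum : ∑ i ∈ Finset.range k, c i = ∑ i ∈ Finset.range n, b i) :
    (∃ x : ℕ → E, (∀ i < k, ‖x i‖ = Real.sqrt (c i)) ∧
        ∀ v : E, B v = ∑ i ∈ Finset.range k, ⟪x i, v⟫_𝕜 • x i) ↔
      (∀ p, 1 ≤ p → p ≤ n - 1 →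
        ∑ i ∈ Finset.range p, c i ≤ ∑ i ∈ Finset.range p, b i) := by
  have hB' := apply_eq_sum_of_orthonormal_eigenvectors hn he heig
  constructor
  · rintro ⟨x, hx, hBx⟩ p hp1 hpn
    refine le_of_eq_of_le (Finset.sum_congr rfl fun i hi => ?_)
      (sum_norm_sq_le_sum_eigenvalues (p := p) (by lia) (by lia : p ≤ k) he hbmono
        (hbpos p (by lia)).le fun v => (hBx v).symm.trans (hB' v))
    have hi : i < k := by have := Finset.mem_range.1 hi; lia
    rw [hx i hi, Real.sq_sqrt (hcpos i hi).le]
  · intro hle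
    have hpad : ∀ p, n ≤ p → ∑ i ∈ Finset.range p, (if i < n then b i else 0) =
        ∑ i ∈ Finset.range n, b i := fun p hp => by
      rw [← Finset.sum_filter]
      congr 1
      ext i
      simp only [Finset.mem_filter, Finset.mem_range]
      lia
    suffices h : ∃ a : ℕ → ℝ, (∃ x : ℕ → E, (∀ i < k, ‖x i‖ ^ 2 = a i) ∧
        ∀ v : E, B v = ∑ i ∈ Finset.range k, ⟪x i, v⟫_𝕜 • x i) ∧ ∀ i < k, a i = c i by
      obtain ⟨a, ⟨x, hx, hBx⟩, hac⟩ := h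
      refine ⟨x, fun i hi => ?_, hBx⟩
      rw [← hac i hi, ← hx i hi, Real.sqrt_sq (norm_nonneg _)]
    refine exists_eqOn_of_transfer_of_sum_range_le (k := k)
      (P := fun a => ∃ x : ℕ → E, (∀ i < k, ‖x i‖ ^ 2 = a i) ∧
        ∀ v : E, B v = ∑ i ∈ Finset.range k, ⟪x i, v⟫_𝕜 • x i) hcmono
      (fun a j l δ hj hl hjl hδ hδ' h => exists_frame_transfer hj hl hjl hδ hδ' h)
      (fun i => if i < n then b i else 0)
      ⟨fun i => if i < n then ((√(b i) : ℝ) : 𝕜) • e i else 0, fun i hi => ?_, fun v => ?_⟩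
      (fun p hpk => ?_) ?_
    · by_cases h : i < n
      · simp only [h, if_true, norm_smul, RCLike.norm_ofReal, mul_pow, sq_abs,
          Real.sq_sqrt (hbpos i h).le]
        rw [he.1 ⟨i, h⟩, one_pow, mul_one]
      · simp [h]
    · rw [hB' v, ← Finset.sum_range_add_sum_Ico _ hnk]
      have hzero : ∀ i ∈ Finset.Ico n k, ¬ i < n := fun i hi => (Finset.mem_Ico.1 hi).1.not_gt
      rw [Finset.sum_eq_zero (s := Finset.Ico n k) fun i hi => by simp [hzero i hi], add_zero]
      refine Finset.sum_congr rfl fun i hi => ?_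
      have hi := Finset.mem_range.1 hi
      simp only [hi, if_true, inner_smul_left, RCLike.conj_ofReal, smul_smul]
      congr 1
      have : ((√(b i) : ℝ) : 𝕜) * ((√(b i) : ℝ) : 𝕜) = (b i : 𝕜) := by
        rw [← RCLike.ofReal_mul, Real.mul_self_sqrt (hbpos i hi).le]
      linear_combination -⟪e i, v⟫_𝕜 * this
    · rcases lt_or_ge p n with hpn | hpn
      · rw [Finset.sum_congr rfl fun i hi =>
          if_pos (show i < n from (Finset.mem_range.1 hi).trans hpn)]
        rcases Nat.eq_zero_or_pos p with rfl | hp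
        · simp
        · exact hle p hp (by lia)
      · rw [hpad p hpn, ← hsum]
        exact Finset.sum_le_sum_of_subset_of_nonneg (Finset.range_mono hpk)
          fun i hi _ => (hcpos i (Finset.mem_range.1 hi)).le
    · rw [hpad k hnk, hsum]
end

section
/- Let H be a real or complex inner product space of finite dimension n, and for some k ≥ n let a_1 ≥ a_2 ≥ ... ≥ a_k > 0 be positive real numbers satisfying the Fundamental Frame Inequality a_1² ≤ (1/n) Σ_{i=1}^k a_i². Then there exist unit vectors x_1, ..., x_k in H such that the vectors y_i = a_i x_i form a tight frame for H with frame bound λ = (1/n) Σ_{i=1}^k a_i²; that is, Σ_{i=1}^k |⟨x, y_i⟩|² = λ‖x‖² for every x in H. -/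
open scoped InnerProductSpace

section Rotation

variable {𝕜 E : Type*} [RCLike 𝕜] [NormedAddCommGroup E] [InnerProductSpace 𝕜 E]

theorem norm_sq_rotation_add (x y : E) {c s : ℝ} (h : c ^ 2 + s ^ 2 = 1) :
    ‖(c : 𝕜) • x + (s : 𝕜) • y‖ ^ 2 + ‖(-s : 𝕜) • x + (c : 𝕜) • y‖ ^ 2 =
      ‖x‖ ^ 2 + ‖y‖ ^ 2 := by
  rw [@norm_add_sq 𝕜, @norm_add_sq 𝕜, ← RCLike.ofReal_neg]
  simp only [norm_smul, inner_smul_left, inner_smul_right, RCLike.conj_ofReal,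
    RCLike.re_ofReal_mul, RCLike.norm_ofReal, mul_pow, sq_abs]
  linear_combination (‖x‖ ^ 2 + ‖y‖ ^ 2) * h

theorem exists_rotation_norm_sq_eq_s6 (x y : E) {t : ℝ} (hy : ‖y‖ ^ 2 ≤ t) (hx : t ≤ ‖x‖ ^ 2) :
    ∃ c s : ℝ, c ^ 2 + s ^ 2 = 1 ∧ ‖(c : 𝕜) • x + (s : 𝕜) • y‖ ^ 2 = t := by
  have hcont : Continuous fun θ : ℝ =>
      ‖((Real.cos θ : ℝ) : 𝕜) • x + ((Real.sin θ : ℝ) : 𝕜) • y‖ ^ 2 := by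
    have hc : Continuous fun θ : ℝ => ((Real.cos θ : ℝ) : 𝕜) :=
      RCLike.continuous_ofReal.comp Real.continuous_cos
    have hs : Continuous fun θ : ℝ => ((Real.sin θ : ℝ) : 𝕜) :=
      RCLike.continuous_ofReal.comp Real.continuous_sin
    fun_prop
  obtain ⟨θ, -, hθ⟩ := intermediate_value_Icc' Real.pi_div_two_pos.le hcont.continuousOn
    (show t ∈ Set.Icc _ _ by simpa using ⟨hy, hx⟩)
  exact ⟨Real.cos θ, Real.sin θ, Real.cos_sq_add_sin_sq θ, hθ⟩

variable {ι : Type*} [Fintype ι]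

theorem Finset.sum_univ_eq_of_pair [DecidableEq ι] {f g : ι → ℝ} {i j : ι} (hij : i ≠ j)
    (hpair : f i + f j = g i + g j) (h : ∀ l, l ≠ i → l ≠ j → f l = g l) :
    ∑ l, f l = ∑ l, g l := by
  have hj : j ∈ Finset.univ.erase i := by simp [hij.symm]
  rw [← Finset.add_sum_erase _ f (Finset.mem_univ i), ← Finset.add_sum_erase _ f hj,
    ← Finset.add_sum_erase _ g (Finset.mem_univ i), ← Finset.add_sum_erase _ g hj,
    Finset.sum_congr rfl fun l hl => h l (by simp_all) (by simp_all)]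
  linarith

/-- Rotating two vectors of a tight frame in their span redistributes their squared norms
without changing the frame bound. -/
theorem exists_tight_frame_of_pair [DecidableEq ι] {r : ℝ} {y : ι → E} {d : ι → ℝ}
    (hy : ∀ v, ∑ l, ‖⟪y l, v⟫_𝕜‖ ^ 2 = r * ‖v‖ ^ 2) {i j : ι} (hij : i ≠ j)
    (hnorm : ∀ l, l ≠ i → l ≠ j → ‖y l‖ ^ 2 = d l)
    (hsum : ‖y i‖ ^ 2 + ‖y j‖ ^ 2 = d i + d j) (hj : ‖y j‖ ^ 2 ≤ d i) (hi : d i ≤ ‖y i‖ ^ 2) :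
    ∃ z : ι → E, (∀ l, ‖z l‖ ^ 2 = d l) ∧
      ∀ v, ∑ l, ‖⟪z l, v⟫_𝕜‖ ^ 2 = r * ‖v‖ ^ 2 := by
  obtain ⟨c, s, hcs, hc⟩ := exists_rotation_norm_sq_eq_s6 (𝕜 := 𝕜) (y i) (y j) hj hi
  have hrot := norm_sq_rotation_add (𝕜 := 𝕜) (y i) (y j) hcs
  let z : ι → E := fun l =>
    if l = i then (c : 𝕜) • y i + (s : 𝕜) • y j
    else if l = j then (-s : 𝕜) • y i + (c : 𝕜) • y j else y l
  have hzi : z i = (c : 𝕜) • y i + (s : 𝕜) • y j := if_pos rfl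
  have hzj : z j = (-s : 𝕜) • y i + (c : 𝕜) • y j := by simp [z, hij.symm]
  have hzl : ∀ l, l ≠ i → l ≠ j → z l = y l := fun l h₁ h₂ => by simp [z, h₁, h₂]
  refine ⟨z, fun l => ?_, fun v => ?_⟩
  · by_cases h₁ : l = i
    · rw [h₁, hzi, hc]
    by_cases h₂ : l = j
    · rw [h₂, hzj]
      linarith
    · rw [hzl l h₁ h₂, hnorm l h₁ h₂]
  · rw [← hy v]
    refine Finset.sum_univ_eq_of_pair hij ?_ fun l h₁ h₂ => by rw [hzl l h₁ h₂]
    rw [hzi, hzj, ← norm_sq_rotation_add (𝕜 := 𝕜) ⟪y i, v⟫_𝕜 ⟪y j, v⟫_𝕜 hcs]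
    simp [inner_add_left, inner_smul_left]

/-- If the prescribed squared norms are all `0` or `r`, a scaled orthonormal basis padded by
zeros is a tight frame. -/
theorem exists_tight_frame_of_eq_zero_or_eq [FiniteDimensional 𝕜 E] {r : ℝ} (hr : 0 < r)
    {d : ι → ℝ} (hd : ∀ i, d i = 0 ∨ d i = r)
    (hsum : ∑ i, d i = Module.finrank 𝕜 E * r) :
    ∃ y : ι → E, (∀ i, ‖y i‖ ^ 2 = d i) ∧
      ∀ v, ∑ i, ‖⟪y i, v⟫_𝕜‖ ^ 2 = r * ‖v‖ ^ 2 := by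
  have hd' : ∀ i, d i = if d i = r then r else 0 := fun i => by
    rcases hd i with h | h <;> simp [h, hr.ne]
  have hcard : Fintype.card {i // d i = r} = Module.finrank 𝕜 E := by
    rw [Finset.sum_congr rfl fun i _ => hd' i, ← Finset.sum_filter, Finset.sum_const,
      nsmul_eq_mul] at hsum
    rw [Fintype.card_subtype]
    exact_mod_cast mul_right_cancel₀ hr.ne' hsum
  let b := (stdOrthonormalBasis 𝕜 E).reindex (Fintype.equivOfCardEq (by simpa using hcard.symm) :
    Fin (Module.finrank 𝕜 E) ≃ {i // d i = r})
  let y : ι → E := fun i => if h : d i = r then ((√r : ℝ) : 𝕜) • b ⟨i, h⟩ else 0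
  refine ⟨y, fun i => ?_, fun v => ?_⟩
  · by_cases h : d i = r
    · simp [y, h, norm_smul, abs_of_nonneg, Real.sq_sqrt hr.le]
    · simp [y, (hd i).resolve_right h, hr.ne]
  · have hzero : ∀ i : {i // ¬ d i = r}, ‖⟪y i, v⟫_𝕜‖ ^ 2 = 0 := fun i => by simp [y, i.2]
    have hone : ∀ i : {i // d i = r}, ‖⟪y i, v⟫_𝕜‖ ^ 2 = r * ‖⟪b i, v⟫_𝕜‖ ^ 2 := fun i => by
      simp [y, i.2, inner_smul_left, mul_pow, Real.sq_sqrt hr.le]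
    rw [← Fintype.sum_subtype_add_sum_subtype (fun i => d i = r),
      Fintype.sum_congr _ _ hone, Fintype.sum_congr _ _ hzero, ← Finset.mul_sum,
      b.sum_sq_norm_inner_right]
    simp

theorem exists_ne_mem_Ioo_of_sum_eq_mul [DecidableEq ι] {r : ℝ} {m : ℕ} {d : ι → ℝ}
    (hd : ∀ i, d i ∈ Set.Icc 0 r) (hsum : ∑ i, d i = m * r) {i : ι} (hi : d i ∈ Set.Ioo 0 r) :
    ∃ j, j ≠ i ∧ d j ∈ Set.Ioo 0 r := by
  by_contra! h
  have hr : 0 < r := hi.1.trans hi.2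
  have hd' : ∀ j ∈ Finset.univ.erase i, d j = if d j = r then r else 0 := fun j hj => by
    have hj' := h j (Finset.ne_of_mem_erase hj)
    split_ifs with hjr
    · exact hjr
    · by_contra h0
      exact hj' ⟨lt_of_le_of_ne (hd j).1 (Ne.symm h0), lt_of_le_of_ne (hd j).2 hjr⟩
  rw [← Finset.add_sum_erase _ d (Finset.mem_univ i), Finset.sum_congr rfl hd',
    ← Finset.sum_filter, Finset.sum_const, nsmul_eq_mul] at hsum
  set p := (Finset.filter (fun j => d j = r) (Finset.univ.erase i)).card
  have h₁ : (p : ℝ) < m := lt_of_mul_lt_mul_right (by linarith [hi.1]) hr.le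
  have h₂ : (m : ℝ) < p + 1 := lt_of_mul_lt_mul_right (by linarith [hi.2]) hr.le
  norm_cast at h₁ h₂
  omega

/-- Squared norms in `[0, r]` summing to `r * dim E` are those of some tight frame with
frame bound `r`. -/
theorem exists_tight_frame_norm_sq_eq [FiniteDimensional 𝕜 E] {r : ℝ} (hr : 0 < r)
    (d : ι → ℝ) (hd : ∀ i, d i ∈ Set.Icc 0 r) (hsum : ∑ i, d i = Module.finrank 𝕜 E * r) :
    ∃ y : ι → E, (∀ i, ‖y i‖ ^ 2 = d i) ∧
      ∀ v, ∑ i, ‖⟪y i, v⟫_𝕜‖ ^ 2 = r * ‖v‖ ^ 2 := by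
  classical
  induction hN : (Finset.univ.filter fun i => d i ∈ Set.Ioo 0 r).card
    using Nat.strong_induction_on generalizing d with
  | _ N ih =>
  by_cases hfrac : ∃ i, d i ∈ Set.Ioo 0 r
  · obtain ⟨i, j, hij, hi, hj, hji⟩ :
        ∃ i j, i ≠ j ∧ d i ∈ Set.Ioo 0 r ∧ d j ∈ Set.Ioo 0 r ∧ d j ≤ d i := by
      obtain ⟨i, hi⟩ := hfrac
      obtain ⟨j, hne, hj⟩ := exists_ne_mem_Ioo_of_sum_eq_mul hd hsum hi
      rcases le_total (d j) (d i) with h | h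
      exacts [⟨i, j, hne.symm, hi, hj, h⟩, ⟨j, i, hne, hj, hi, h⟩]
    set δ := min (r - d i) (d j) with hδ
    have hδi : δ ≤ r - d i := min_le_left _ _
    have hδj : δ ≤ d j := min_le_right _ _
    have hδ0 : 0 < δ := lt_min (by linarith [hi.2]) hj.1
    let d' : ι → ℝ := fun l => if l = i then d i + δ else if l = j then d j - δ else d l
    have hi' : d' i = d i + δ := if_pos rfl
    have hj' : d' j = d j - δ := by simp [d', hij.symm]
    have hl' : ∀ l, l ≠ i → l ≠ j → d' l = d l := fun l h₁ h₂ => by simp [d', h₁, h₂]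
    have hd' : ∀ l, d' l ∈ Set.Icc 0 r := fun l => by
      by_cases h₁ : l = i
      · rw [h₁, hi']
        constructor <;> linarith [hi.1]
      by_cases h₂ : l = j
      · rw [h₂, hj']
        constructor <;> linarith [hj.2]
      · rw [hl' l h₁ h₂]
        exact hd l
    have hsum' : ∑ l, d' l = Module.finrank 𝕜 E * r := by
      rw [← hsum]
      exact Finset.sum_univ_eq_of_pair hij (by rw [hi', hj']; ring) hl'
    have hsub : (Finset.univ.filter fun l => d' l ∈ Set.Ioo 0 r) ⊆
        Finset.univ.filter fun l => d l ∈ Set.Ioo 0 r := fun l hl => by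
      rw [Finset.mem_filter] at hl ⊢
      by_cases h₁ : l = i
      · exact ⟨hl.1, h₁ ▸ hi⟩
      by_cases h₂ : l = j
      · exact ⟨hl.1, h₂ ▸ hj⟩
      · rwa [hl' l h₁ h₂] at hl
    have hlt : (Finset.univ.filter fun l => d' l ∈ Set.Ioo 0 r).card < N := by
      rw [← hN]
      refine Finset.card_lt_card (hsub.ssubset_of_ne fun heq => ?_)
      have hmem : ∀ l, d l ∈ Set.Ioo 0 r → d' l ∈ Set.Ioo 0 r := fun l hl => by
        simpa using heq.ge (by simpa using hl : l ∈ Finset.univ.filter fun l => d l ∈ Set.Ioo 0 r)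
      have h₁ := (hmem i hi).2
      have h₂ := (hmem j hj).1
      rcases min_choice (r - d i) (d j) with h | h <;> rw [← hδ] at h <;> linarith
    obtain ⟨y, hnorm, hy⟩ := ih _ hlt d' hd' hsum' rfl
    refine exists_tight_frame_of_pair hy hij (fun l h₁ h₂ => by rw [hnorm, hl' l h₁ h₂]) ?_ ?_ ?_
    all_goals simp only [hnorm, hi', hj']
    all_goals linarith
  · push Not at hfrac
    refine exists_tight_frame_of_eq_zero_or_eq hr (fun i => ?_) hsum
    by_contra! h
    exact hfrac i ⟨lt_of_le_of_ne (hd i).1 h.1.symm, lt_of_le_of_ne (hd i).2 h.2⟩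

end Rotation

/-- Let `H` be a real or complex inner product space of finite dimension `n`, and for `k ≥ n`
let `a 0 ≥ a 1 ≥ ⋯ ≥ a (k-1) > 0` satisfy the Fundamental Frame Inequality
`a 0 ^ 2 ≤ (1/n) ∑_{i<k} a i ^ 2`. Then there exist unit vectors `x i` such that the vectors
`y i = a i • x i` form a tight frame for `H` with frame bound `λ = (1/n) ∑_{i<k} a i ^ 2`:
for every `v`, `∑_{i<k} |⟨v, y i⟩|² = λ ‖v‖²`. -/
theorem tight_frame_of_fundamental_frame_inequality {𝕜 E : Type*} [RCLike 𝕜]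
    [NormedAddCommGroup E] [InnerProductSpace 𝕜 E] [FiniteDimensional 𝕜 E] [CompleteSpace E]
    (n k : ℕ) (hn : Module.finrank 𝕜 E = n) (hn0 : 0 < n) (hnk : n ≤ k)
    (a : ℕ → ℝ)
    (hamono : ∀ i j, i ≤ j → j < k → a j ≤ a i)
    (hapos : ∀ i < k, 0 < a i)
    (hffi : a 0 ^ 2 ≤ (1 / (n : ℝ)) * ∑ i ∈ Finset.range k, a i ^ 2) :
    ∃ x : ℕ → E, (∀ i < k, ‖x i‖ = 1) ∧
      ∀ v : E, ∑ i ∈ Finset.range k, ‖⟪(a i : 𝕜) • x i, v⟫_𝕜‖ ^ 2 =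
        ((1 / (n : ℝ)) * ∑ i ∈ Finset.range k, a i ^ 2) * ‖v‖ ^ 2 := by
  set r := (1 / (n : ℝ)) * ∑ i ∈ Finset.range k, a i ^ 2 with hr
  have hr0 : 0 < r := (pow_pos (hapos 0 (hn0.trans_le hnk)) 2).trans_le hffi
  obtain ⟨y, hnorm, hy⟩ := exists_tight_frame_norm_sq_eq (𝕜 := 𝕜) (E := E) hr0
    (fun i : Fin k => a i ^ 2)
    (fun i => ⟨sq_nonneg _, (pow_le_pow_left₀ (hapos i i.2).le
      (hamono 0 i (Nat.zero_le _) i.2) 2).trans hffi⟩)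
    (by
      rw [hn, Fin.sum_univ_eq_sum_range (fun i => a i ^ 2) k, hr]
      have : (n : ℝ) ≠ 0 := by exact_mod_cast hn0.ne'
      field_simp)
  have hnorm' : ∀ i : Fin k, ‖y i‖ = a i := fun i =>
    (pow_left_inj₀ (norm_nonneg _) (hapos i i.2).le two_ne_zero).1 (hnorm i)
  refine ⟨fun i => if h : i < k then ((a i : ℝ) : 𝕜)⁻¹ • y ⟨i, h⟩ else 0, fun i hi => ?_,
    fun v => ?_⟩
  · simp [hi, norm_smul, hnorm', abs_of_pos (hapos i hi), (hapos i hi).ne']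
  · rw [← hy v, ← Fin.sum_univ_eq_sum_range (fun i => ‖⟪(a i : 𝕜) •
      (if h : i < k then ((a i : ℝ) : 𝕜)⁻¹ • y ⟨i, h⟩ else 0), v⟫_𝕜‖ ^ 2) k]
    refine Fintype.sum_congr _ _ fun i => ?_
    have ha : ((a i : ℝ) : 𝕜) ≠ 0 := RCLike.ofReal_ne_zero.2 (hapos i i.2).ne'
    rw [dif_pos i.2, smul_inv_smul₀ ha]
end
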